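/- Let h : ℝ × ℝ² → ℝ and u : ℝ × ℝ² → ℝ² be C² with h > 0 and ‖∇ₓh‖ > 0 everywhere, satisfying the mass conservation law ∂ₜh + div(h·u) = 0. Let σ : ℝ → ℝ be C¹ and positive and α : ℝ → ℝ be C¹ and positive, and set q := ‖∇ₓh‖ and v := α(q²)·√(σ(h)/h)·∇ₓh. Then h·v satisfies the evolution equation ∂ₜ(h·v) + div((h·v) ⊗ u) = −f(h,v)·div(h·(∇ₓu)ᵀ) − g(h,v)·div u, where f(h,v) := √(σ(h))·√h·( (2·α'(q²)·h/(α(q²)²·σ(h)))·(v ⊗ v) + α(q²)·I ) and g(h,v) := ( σ'(h)·h/(2σ(h)) + 1/2 + 2·α'(q²)·q²/α(q²) )·h·v. -/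

import Mathlib

noncomputable section

/-- Spatial points of the plane (with the Euclidean structure). -/
abbrev Spc : Type := EuclideanSpace ℝ (Fin 2)

/-- Time derivative `∂ₜ f` of a scalar field on time-space `ℝ × ℝ²`. -/
noncomputable def dt (f : ℝ × Spc → ℝ) (z : ℝ × Spc) : ℝ :=
  fderiv ℝ f z (1, 0)

/-- Spatial partial derivative `∂ⱼ f` of a scalar field on time-space `ℝ × ℝ²`. -/
noncomputable def dx (j : Fin 2) (f : ℝ × Spc → ℝ) (z : ℝ × Spc) : ℝ :=
  fderiv ℝ f z (0, EuclideanSpace.single j 1)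

/-- Spatial gradient `∇ₓ f` (as a Euclidean vector) of a scalar field. -/
noncomputable def gradx (f : ℝ × Spc → ℝ) (z : ℝ × Spc) : Spc :=
  (WithLp.equiv 2 (Fin 2 → ℝ)).symm (fun i => dx i f z)

/-- Second directional derivatives of a `C²` scalar field commute. -/
theorem fderiv_fderiv_apply_comm {E : Type*} [NormedAddCommGroup E] [NormedSpace ℝ E]
    {f : E → ℝ} (hf : ContDiff ℝ 2 f) (z a b : E) :
    fderiv ℝ (fun y => fderiv ℝ f y a) z b = fderiv ℝ (fun y => fderiv ℝ f y b) z a := by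
  have hd : DifferentiableAt ℝ (fderiv ℝ f) z :=
    ((hf.fderiv_right (m := 1) (by norm_num)).differentiable (by norm_num)) z
  have hs : IsSymmSndFDerivAt ℝ f z :=
    hf.contDiffAt.isSymmSndFDerivAt (by simp)
  rw [fderiv_clm_apply hd (differentiableAt_const a),
    fderiv_clm_apply hd (differentiableAt_const b)]
  simpa using hs.eq b a

/-- A directional derivative of a `C²` scalar field is differentiable. -/
theorem differentiable_fderiv_apply {E : Type*} [NormedAddCommGroup E] [NormedSpace ℝ E]
    {f : E → ℝ} (hf : ContDiff ℝ 2 f) (a : E) :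
    Differentiable ℝ (fun y => fderiv ℝ f y a) :=
  ((hf.fderiv_right (m := 1) (by norm_num)).differentiable (by norm_num)).clm_apply
    (differentiable_const a)

/-- The product rule for directional derivatives. -/
theorem fderiv_mul_apply {E : Type*} [NormedAddCommGroup E] [NormedSpace ℝ E]
    {f g : E → ℝ} {z : E} (hf : DifferentiableAt ℝ f z) (hg : DifferentiableAt ℝ g z) (e : E) :
    fderiv ℝ (fun y => f y * g y) z e = f z * fderiv ℝ g z e + fderiv ℝ f z e * g z := by
  rw [fderiv_fun_mul hf hg]
  simp [mul_comm]

/-- Differentiability of, and the chain rule for, `α(p₀² + p₁²) · √(σ(h)/h) · r`. -/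
theorem differentiableAt_and_fderiv_auxVelocity {E : Type*} [NormedAddCommGroup E] [NormedSpace ℝ E]
    {h p₀ p₁ r : E → ℝ} {σ α : ℝ → ℝ} {z : E}
    (hh : DifferentiableAt ℝ h z) (hp₀ : DifferentiableAt ℝ p₀ z)
    (hp₁ : DifferentiableAt ℝ p₁ z) (hr : DifferentiableAt ℝ r z)
    (hσ : Differentiable ℝ σ) (hα : Differentiable ℝ α)
    (hpos : 0 < h z) (hσpos : 0 < σ (h z)) :
    DifferentiableAt ℝ (fun y => α (p₀ y ^ 2 + p₁ y ^ 2) * √(σ (h y) / h y) * r y) z ∧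
    ∀ e, fderiv ℝ (fun y => α (p₀ y ^ 2 + p₁ y ^ 2) * √(σ (h y) / h y) * r y) z e =
      √(σ (h z) / h z) *
        (deriv α (p₀ z ^ 2 + p₁ z ^ 2) *
            (2 * p₀ z * fderiv ℝ p₀ z e + 2 * p₁ z * fderiv ℝ p₁ z e) * r z
          + α (p₀ z ^ 2 + p₁ z ^ 2) *
            ((deriv σ (h z) / σ (h z) - 1 / h z) / 2 * fderiv ℝ h z e) * r z
          + α (p₀ z ^ 2 + p₁ z ^ 2) * fderiv ℝ r z e) := by
  have hA := (hα _).hasDerivAt.comp_hasFDerivAt z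
    ((hp₀.hasFDerivAt.pow 2).add (hp₁.hasFDerivAt.pow 2))
  have hq : HasDerivAt (fun s => √(σ s / s)) _ (h z) :=
    (((hσ (h z)).hasDerivAt.div (hasDerivAt_id (h z)) hpos.ne').sqrt
      (div_pos hσpos hpos).ne')
  have hS := hq.comp_hasFDerivAt z hh.hasFDerivAt
  have H := (hA.mul hS).mul hr.hasFDerivAt
  refine ⟨H.differentiableAt, fun e => ?_⟩
  refine (congrArg (fun L => L e) H.fderiv).trans ?_
  have hs : √(σ (h z) / h z) ≠ 0 := (Real.sqrt_pos.2 (div_pos hσpos hpos)).ne'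
  have hs2 : σ (h z) = √(σ (h z) / h z) ^ 2 * h z := by
    rw [Real.sq_sqrt (div_pos hσpos hpos).le]; field_simp
  simp
  generalize √(σ (h z) / h z) = S at *
  rw [hs2]
  have := hpos.ne'
  field_simp
  ring

/-- (Key computation of Lemma 2.1(i).) Under mass conservation
`∂ₜh + div(h·u) = 0`, with `q := ‖∇ₓh‖ > 0`, `v := α(q²)·√(σ(h)/h)·∇ₓh`,
`f(h,v) := √(σ(h))·√h·((2α'(q²)h/(α(q²)²σ(h)))·(v ⊗ v) + α(q²)·I)` and
`g(h,v) := (σ'(h)h/(2σ(h)) + 1/2 + 2α'(q²)q²/α(q²))·h·v`, the auxiliary momentum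
satisfies `∂ₜ(h·v) + div((h·v) ⊗ u) = −f(h,v)·div(h·(∇ₓu)ᵀ) − g(h,v)·div u`. -/
theorem stmt9 (h : ℝ × Spc → ℝ) (u : ℝ × Spc → Spc) (σ α : ℝ → ℝ)
    (hh : ContDiff ℝ 2 h) (hu : ContDiff ℝ 2 u)
    (hσ : ContDiff ℝ 1 σ) (hα : ContDiff ℝ 1 α)
    (hpos : ∀ z, 0 < h z) (hσpos : ∀ s, 0 < σ s) (hαpos : ∀ s, 0 < α s)
    (mass : ∀ z, dt h z + ∑ j, dx j (fun y => h y * u y j) z = 0)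
    (q : ℝ × Spc → ℝ) (hq : ∀ z, q z = ‖gradx h z‖) (hqpos : ∀ z, 0 < q z)
    (v : ℝ × Spc → Fin 2 → ℝ)
    (hv : ∀ z i, v z i = α (q z ^ 2) * Real.sqrt (σ (h z) / h z) * dx i h z)
    (f : ℝ × Spc → Matrix (Fin 2) (Fin 2) ℝ)
    (hf : ∀ z, f z = (Real.sqrt (σ (h z)) * Real.sqrt (h z)) •
        ((2 * deriv α (q z ^ 2) * h z / (α (q z ^ 2) ^ 2 * σ (h z))) •
            Matrix.vecMulVec (v z) (v z)
          + α (q z ^ 2) • (1 : Matrix (Fin 2) (Fin 2) ℝ)))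
    (g : ℝ × Spc → Fin 2 → ℝ)
    (hg : ∀ z, g z = ((deriv σ (h z) * h z / (2 * σ (h z)) + 1 / 2
        + 2 * deriv α (q z ^ 2) * q z ^ 2 / α (q z ^ 2)) * h z) • v z) :
    ∀ (z : ℝ × Spc) (i : Fin 2),
      dt (fun y => h y * v y i) z + ∑ j, dx j (fun y => h y * v y i * u y j) z
        = -(∑ j, f z i j * ∑ k, dx k (fun y => h y * dx j (fun y' => u y' k) y) z)
          - g z i * ∑ j, dx j (fun y => u y j) z := by
  intro z i
  have hu' (j : Fin 2) : ContDiff ℝ 2 (fun y => u y j) := by fun_prop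
  have hud (j : Fin 2) : Differentiable ℝ (fun y => u y j) := (hu' j).differentiable (by norm_num)
  have hhd : Differentiable ℝ h := hh.differentiable (by norm_num)
  have hp (j : Fin 2) : Differentiable ℝ (fun y => dx j h y) := differentiable_fderiv_apply hh _
  have hup (j k : Fin 2) : Differentiable ℝ (fun y => dx j (fun y' => u y' k) y) :=
    differentiable_fderiv_apply (hu' k) _
  have hq2 (y) : q y ^ 2 = dx 0 h y ^ 2 + dx 1 h y ^ 2 := by
    rw [hq, EuclideanSpace.norm_sq_eq]; simp [gradx]
  have hvf (i : Fin 2) : (fun y => v y i) = fun y =>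
      α (dx 0 h y ^ 2 + dx 1 h y ^ 2) * √(σ (h y) / h y) * dx i h y := by
    funext y; rw [hv, hq2]
  obtain ⟨hvd, hve⟩ := differentiableAt_and_fderiv_auxVelocity (hhd z) (hp 0 z) (hp 1 z) (hp i z)
    (hσ.differentiable (by norm_num)) (hα.differentiable (by norm_num)) (hpos z) (hσpos _)
  rw [← hvf i] at hvd hve
  have hmass (y) : dt h y + ((h y * dx 0 (fun y => u y 0) y + dx 0 h y * u y 0)
      + (h y * dx 1 (fun y => u y 1) y + dx 1 h y * u y 1)) = 0 := by
    have := mass y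
    rw [Fin.sum_univ_two] at this
    simpa only [dx, fderiv_mul_apply (hhd y) (hud _ y)] using this
  have hmass' : dt h = fun y => -((h y * dx 0 (fun y => u y 0) y + dx 0 h y * u y 0)
      + (h y * dx 1 (fun y => u y 1) y + dx 1 h y * u y 1)) := by
    funext y; linarith [hmass y]
  have hsymm (j k : Fin 2) : dx k (dx j h) z = dx j (dx k h) z :=
    fderiv_fderiv_apply_comm hh z _ _
  have hsymmu (j k l : Fin 2) : dx k (dx j fun y => u y l) z = dx j (dx k fun y => u y l) z :=
    fderiv_fderiv_apply_comm (hu' l) z _ _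
  have hmul {a b : ℝ × Spc → ℝ} (ha : Differentiable ℝ a) (hb : Differentiable ℝ b) (k : Fin 2) :
      dx k (fun y => a y * b y) z = a z * dx k b z + dx k a z * b z :=
    fderiv_mul_apply (ha z) (hb z) _
  have hpt (j : Fin 2) : dt (dx j h) z =
      -((h z * dx j (dx 0 fun y => u y 0) z + dx j h z * dx 0 (fun y => u y 0) z
          + (dx 0 h z * dx j (fun y => u y 0) z + dx j (dx 0 h) z * u z 0))
        + (h z * dx j (dx 1 fun y => u y 1) z + dx j h z * dx 1 (fun y => u y 1) z
          + (dx 1 h z * dx j (fun y => u y 1) z + dx j (dx 1 h) z * u z 1))) := by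
    have h1 : dt (dx j h) z = dx j (dt h) z := fderiv_fderiv_apply_comm hh z _ _
    have h2 (l : Fin 2) : Differentiable ℝ (fun y => h y * dx l (fun y => u y l) y) :=
      hhd.mul (hup l l)
    have h3 (l : Fin 2) : Differentiable ℝ (fun y => dx l h y * u y l) := (hp l).mul (hud l)
    have h4 (l : Fin 2) : Differentiable ℝ
        (fun y => h y * dx l (fun y => u y l) y + dx l h y * u y l) := (h2 l).add (h3 l)
    rw [h1, hmass', ← hmul hhd (hup 0 0), ← hmul hhd (hup 1 1), ← hmul (hp 0) (hud 0),
      ← hmul (hp 1) (hud 1)]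
    unfold dx at h2 h3 h4 ⊢
    rw [fderiv_fun_neg, fderiv_fun_add (h4 0 z) (h4 1 z),
      fderiv_fun_add (h2 0 z) (h3 0 z), fderiv_fun_add (h2 1 z) (h3 1 z)]
    simp
  have hhv : DifferentiableAt ℝ (fun y => h y * v y i) z := (hhd z).mul hvd
  have L1 : dt (fun y => h y * v y i) z = h z * dt (fun y => v y i) z + dt h z * v z i :=
    fderiv_mul_apply (hhd z) hvd _
  have L2 (j : Fin 2) : dx j (fun y => h y * v y i * u y j) z =
      h z * v z i * dx j (fun y => u y j) z
        + (h z * dx j (fun y => v y i) z + dx j h z * v z i) * u z j := by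
    rw [dx, fderiv_mul_apply hhv (hud j z), fderiv_mul_apply (hhd z) hvd]; rfl
  have hvt := hve (1, 0)
  have hvx (j : Fin 2) := hve (0, EuclideanSpace.single j 1)
  have e1 : dt h z = _ := congrFun hmass' z
  change dt (fun y => v y i) z = √(σ (h z) / h z) * (deriv α (dx 0 h z ^ 2 + dx 1 h z ^ 2) *
      (2 * dx 0 h z * dt (dx 0 h) z + 2 * dx 1 h z * dt (dx 1 h) z) * dx i h z
    + α (dx 0 h z ^ 2 + dx 1 h z ^ 2) *
      ((deriv σ (h z) / σ (h z) - 1 / h z) / 2 * dt h z) * dx i h z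
    + α (dx 0 h z ^ 2 + dx 1 h z ^ 2) * dt (dx i h) z) at hvt
  change ∀ j, dx j (fun y => v y i) z =
    √(σ (h z) / h z) * (deriv α (dx 0 h z ^ 2 + dx 1 h z ^ 2) *
      (2 * dx 0 h z * dx j (dx 0 h) z + 2 * dx 1 h z * dx j (dx 1 h) z) * dx i h z
    + α (dx 0 h z ^ 2 + dx 1 h z ^ 2) *
      ((deriv σ (h z) / σ (h z) - 1 / h z) / 2 * dx j h z) * dx i h z
    + α (dx 0 h z ^ 2 + dx 1 h z ^ 2) * dx j (dx i h) z) at hvx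
  have hS : 0 < √(σ (h z) / h z) := Real.sqrt_pos.2 (div_pos (hσpos _) (hpos z))
  have hσh : √(σ (h z)) * √(h z) = √(σ (h z) / h z) * h z := by
    rw [Real.sqrt_div (hσpos _).le, div_mul_eq_mul_div, eq_div_iff (Real.sqrt_pos.2 (hpos z)).ne',
      mul_assoc, Real.mul_self_sqrt (hpos z).le]
  have hs2 : σ (h z) = √(σ (h z) / h z) ^ 2 * h z := by
    rw [Real.sq_sqrt (div_pos (hσpos _) (hpos z)).le, div_mul_cancel₀ _ (hpos z).ne']
  have R (j k : Fin 2) : dx k (fun y => h y * dx j (fun y' => u y' k) y) z =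
      h z * dx j (dx k fun y => u y k) z + dx k h z * dx j (fun y => u y k) z := by
    rw [hmul hhd (hup j k), ← hsymmu j k k]
  have hfz (j : Fin 2) : f z i j = √(σ (h z) / h z) * h z *
      (2 * deriv α (dx 0 h z ^ 2 + dx 1 h z ^ 2) * dx i h z * dx j h z
        + α (dx 0 h z ^ 2 + dx 1 h z ^ 2) * if i = j then 1 else 0) := by
    simp only [hf, hv, hq2, hσh, Matrix.smul_apply, Matrix.add_apply, Matrix.vecMulVec_apply,
      Matrix.one_apply, smul_eq_mul]
    have hα0 := (hαpos (dx 0 h z ^ 2 + dx 1 h z ^ 2)).ne'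
    have hz := (hpos z).ne'
    have hS' := hS.ne'
    generalize √(σ (h z) / h z) = S at *
    rw [hs2]
    field_simp
  have hgz : g z i = √(σ (h z) / h z) * h z * dx i h z *
      ((deriv σ (h z) * h z / σ (h z) + 1) / 2 * α (dx 0 h z ^ 2 + dx 1 h z ^ 2)
        + 2 * deriv α (dx 0 h z ^ 2 + dx 1 h z ^ 2) * (dx 0 h z ^ 2 + dx 1 h z ^ 2)) := by
    simp only [hg, hv, hq2, Pi.smul_apply, smul_eq_mul]
    have hα0 := (hαpos (dx 0 h z ^ 2 + dx 1 h z ^ 2)).ne'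
    have hσ0 := (hσpos (h z)).ne'
    field_simp
  have hvz : v z i = α (dx 0 h z ^ 2 + dx 1 h z ^ 2) * √(σ (h z) / h z) * dx i h z :=
    congrFun (hvf i) z
  have hz := (hpos z).ne'
  have hσ0 := (hσpos (h z)).ne'
  simp only [Fin.sum_univ_two, L1, L2, R, hfz, hgz, hvt, hvx, hvz, hpt]
  rw [e1]
  have hsymm01 := hsymm 0 1
  generalize √(σ (h z) / h z) = S at *
  generalize deriv σ (h z) = σ' at *
  generalize σ (h z) = s at *
  generalize deriv α (dx 0 h z ^ 2 + dx 1 h z ^ 2) = α' at *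
  generalize α (dx 0 h z ^ 2 + dx 1 h z ^ 2) = a at *
  fin_cases i
  all_goals
    simp [hsymm01]
    field_simp
    ring


end
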